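/- Assume moreover that a2 = 1 (so a1 ≥ 5). Then for every μ ∈ P, the Weyl group orbit Wμ satisfies Wμ ∩ (P+ ∪ (−P+)) = ∅ if and only if Wμ contains an element λ = k1Λ1 − k2Λ2 with k1, k2 ∈ ℤ>0 such that 2k2 ≤ k1 ≤ (a1−2)k2. -/

import Mathlib

namespace HypWeyl

/-- the simple reflection `s1` on `P = ℤΛ1 ⊕ ℤΛ2`, in `(Λ1, Λ2)`-coordinates:
`s1(μ) = μ − ⟨μ, α1^∨⟩ α1` with `α1 = (2, −a2)`. -/
def s1 (a2 : ℤ) (μ : ℤ × ℤ) : ℤ × ℤ := (-μ.1, μ.2 + a2 * μ.1)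

/-- the simple reflection `s2`: `s2(μ) = μ − ⟨μ, α2^∨⟩ α2` with `α2 = (−a1, 2)`. -/
def s2 (a1 : ℤ) (μ : ℤ × ℤ) : ℤ × ℤ := (μ.1 + a1 * μ.2, -μ.2)

def refl (a1 a2 : ℤ) (b : Bool) : ℤ × ℤ → ℤ × ℤ := if b then s1 a2 else s2 a1

/-- the Weyl group orbit `Wμ` (the generators `s1, s2` are involutions, so the
group generated by them coincides with the monoid generated by them). -/
def orbit (a1 a2 : ℤ) (μ : ℤ × ℤ) : Set (ℤ × ℤ) :=
  {ν | ∃ l : List Bool, ν = l.foldl (fun w b => refl a1 a2 b w) μ}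

/-- the set `P+` of dominant integral weights. -/
def Pplus : Set (ℤ × ℤ) := {ν | 0 ≤ ν.1 ∧ 0 ≤ ν.2}

end HypWeyl

namespace HypWeyl

theorem self_mem_orbit (a1 a2 : ℤ) (μ : ℤ × ℤ) : μ ∈ orbit a1 a2 μ := ⟨[], rfl⟩

theorem refl_mem_orbit {a1 a2 : ℤ} {μ ν : ℤ × ℤ} (b : Bool) (h : ν ∈ orbit a1 a2 μ) :
    refl a1 a2 b ν ∈ orbit a1 a2 μ := by
  obtain ⟨l, rfl⟩ := h
  exact ⟨l ++ [b], by simp⟩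

theorem s1_mem_orbit {a1 a2 : ℤ} {μ : ℤ × ℤ} {x y : ℤ} (h : (x, y) ∈ orbit a1 a2 μ) :
    (-x, y + a2 * x) ∈ orbit a1 a2 μ := by
  simpa [refl, s1] using refl_mem_orbit true h

theorem s2_mem_orbit {a1 a2 : ℤ} {μ : ℤ × ℤ} {x y : ℤ} (h : (x, y) ∈ orbit a1 a2 μ) :
    (x + a1 * y, -y) ∈ orbit a1 a2 μ := by
  simpa [refl, s2] using refl_mem_orbit false h

/-- A `W`-invariant quadratic form on `P`. -/
def quadForm (a1 a2 : ℤ) (μ : ℤ × ℤ) : ℤ :=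
  a2 * μ.1 ^ 2 + a1 * a2 * μ.1 * μ.2 + a1 * μ.2 ^ 2

theorem quadForm_refl (a1 a2 : ℤ) (b : Bool) (μ : ℤ × ℤ) :
    quadForm a1 a2 (refl a1 a2 b μ) = quadForm a1 a2 μ := by
  cases b <;> simp [refl, s1, s2, quadForm] <;> ring

theorem quadForm_eq_of_mem_orbit {a1 a2 : ℤ} {μ ν : ℤ × ℤ} (h : ν ∈ orbit a1 a2 μ) :
    quadForm a1 a2 ν = quadForm a1 a2 μ := by
  obtain ⟨l, rfl⟩ := h
  induction l generalizing μ with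
  | nil => rfl
  | cons b l ih => rw [List.foldl_cons, ih, quadForm_refl]

theorem quadForm_neg (a1 a2 : ℤ) (μ : ℤ × ℤ) : quadForm a1 a2 (-μ) = quadForm a1 a2 μ := by
  simp [quadForm]

theorem quadForm_nonneg_of_mem_Pplus {a1 a2 : ℤ} (ha1 : 0 ≤ a1) (ha2 : 0 ≤ a2) {ν : ℤ × ℤ}
    (h : ν ∈ Pplus) : 0 ≤ quadForm a1 a2 ν := by
  obtain ⟨hx, hy⟩ := h
  unfold quadForm
  positivity

theorem sign_of_avoids {ν : ℤ × ℤ} (h : ¬(ν ∈ Pplus ∨ -ν ∈ Pplus)) :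
    (0 < ν.1 ∧ ν.2 < 0) ∨ (ν.1 < 0 ∧ 0 < ν.2) := by
  simp only [Pplus, Set.mem_ofPred_eq, Prod.fst_neg, Prod.snd_neg] at h
  omega

/-- Descent on `k2`: outside the cone `2 * k2 ≤ k1 ≤ (a1 - 2) * k2`, one of `s1 s2`, `s2 s1`
maps `(k1, -k2)` to a weight of the same shape with smaller `k2`. -/
theorem exists_mem_cone_of_avoids {a1 : ℤ} {μ : ℤ × ℤ}
    (h : ∀ ν ∈ orbit a1 1 μ, ¬(ν ∈ Pplus ∨ -ν ∈ Pplus)) (n : ℕ) :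
    ∀ k1 k2 : ℤ, k2 ≤ n → 0 < k1 → 0 < k2 → (k1, -k2) ∈ orbit a1 1 μ →
      ∃ k1 k2 : ℤ, 0 < k1 ∧ 0 < k2 ∧ (k1, -k2) ∈ orbit a1 1 μ ∧
        (2 * k2 ≤ k1 ∧ k1 ≤ (a1 - 2) * k2) := by
  induction n with
  | zero => intro k1 k2 hn _ hk2; omega
  | succ n ih =>
    intro k1 k2 hn hk1 hk2 hmem
    push_cast at hn
    by_cases hlow : 2 * k2 ≤ k1
    · by_cases hhigh : k1 ≤ (a1 - 2) * k2
      · exact ⟨k1, k2, hk1, hk2, hmem, hlow, hhigh⟩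
      · have hmem₂ := s2_mem_orbit hmem
        have hmem₁₂ := s1_mem_orbit hmem₂
        have hsign₂ := sign_of_avoids (h _ hmem₂)
        have hsign₁₂ := sign_of_avoids (h _ hmem₁₂)
        dsimp only at hsign₂ hsign₁₂
        refine ih (a1 * k2 - k1) (a1 * k2 - k1 - k2) ?_ ?_ ?_ ?_
        · linarith
        · grind
        · grind
        · convert hmem₁₂ using 2 <;> ring
    · have hmem₁ := s1_mem_orbit hmem
      have hmem₂₁ := s2_mem_orbit hmem₁
      have hsign₁ := sign_of_avoids (h _ hmem₁)
      have hsign₂₁ := sign_of_avoids (h _ hmem₂₁)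
      dsimp only at hsign₁ hsign₂₁
      refine ih (-k1 + a1 * (k1 - k2)) (k1 - k2) ?_ ?_ ?_ ?_
      · linarith
      · grind
      · grind
      · convert hmem₂₁ using 2 <;> ring

end HypWeyl

open HypWeyl in
theorem orbit_avoids_dominant_iff_of_a2_eq_one
    (a1 a2 : ℤ) (ha1 : 1 ≤ a1) (ha2 : a2 = 1) (ha : 4 < a1 * a2) (μ : ℤ × ℤ) :
    (∀ ν ∈ orbit a1 a2 μ, ¬(ν ∈ Pplus ∨ -ν ∈ Pplus)) ↔
      ∃ k1 k2 : ℤ, 0 < k1 ∧ 0 < k2 ∧ (k1, -k2) ∈ orbit a1 a2 μ ∧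
        (2 * k2 ≤ k1 ∧ k1 ≤ (a1 - 2) * k2) := by
  subst ha2
  have ha4 : 4 < a1 := by simpa using ha
  constructor
  · intro h
    have descend : ∀ k1 k2 : ℤ, 0 < k1 → 0 < k2 → (k1, -k2) ∈ orbit a1 1 μ →
        ∃ k1 k2 : ℤ, 0 < k1 ∧ 0 < k2 ∧ (k1, -k2) ∈ orbit a1 1 μ ∧
          (2 * k2 ≤ k1 ∧ k1 ≤ (a1 - 2) * k2) := fun k1 k2 =>
      exists_mem_cone_of_avoids h k2.toNat k1 k2 (Int.self_le_toNat k2)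
    obtain ⟨x, y⟩ := μ
    have hmem := self_mem_orbit a1 1 (x, y)
    rcases sign_of_avoids (h _ hmem) with ⟨hx, hy⟩ | ⟨hx, hy⟩
    · exact descend x (-y) hx (neg_pos.2 hy) (by simpa using hmem)
    · have hmem₁ := s1_mem_orbit hmem
      have hsign₁ := sign_of_avoids (h _ hmem₁)
      dsimp only at hx hy hsign₁
      exact descend (-x) (-(y + 1 * x)) (by omega) (by omega) (by simpa using hmem₁)
  · rintro ⟨k1, k2, hk1, hk2, hmem, hlow, hhigh⟩ ν hν hdom
    have hneg : quadForm a1 1 (k1, -k2) < 0 := by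
      unfold quadForm
      nlinarith [mul_nonneg (sub_nonneg.2 hlow) (sub_nonneg.2 hhigh),
        mul_pos (sub_pos.2 ha4) (pow_pos hk2 2)]
    have hnonneg : 0 ≤ quadForm a1 1 ν := by
      rcases hdom with hdom | hdom
      · exact quadForm_nonneg_of_mem_Pplus (by omega) zero_le_one hdom
      · rw [← quadForm_neg]
        exact quadForm_nonneg_of_mem_Pplus (by omega) zero_le_one hdom
    rw [quadForm_eq_of_mem_orbit hmem] at hneg
    rw [quadForm_eq_of_mem_orbit hν] at hnonneg
    omega
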